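/- Let f : ℝ³ → ℝ be three times continuously differentiable, and fix y ∈ ℝ³ and c ∈ ℝ³. Then the vector field u(x) = Q(x)·(Hess f)(x−y)·Q(y)·c is divergence-free on ℝ³: for every x ∈ ℝ³, ∑_{i=1}^{3} ∂uᵢ/∂xᵢ(x) = 0. -/

import Mathlib

open Matrix

/-- The matrix `Q(x)` whose action on a vector `v` is the cross product `x × v`. -/
def Qmat (x : Fin 3 → ℝ) : Matrix (Fin 3) (Fin 3) ℝ :=
  !![0, -x 2, x 1; x 2, 0, -x 0; -x 1, x 0, 0]

/-- The Hessian matrix of `f : ℝ³ → ℝ` at `v`: its `(i,j)` entry is the second partial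
derivative `∂²f/∂vᵢ∂vⱼ` taken along the standard basis directions. -/
noncomputable def hessMat (f : (Fin 3 → ℝ) → ℝ) (v : Fin 3 → ℝ) :
    Matrix (Fin 3) (Fin 3) ℝ :=
  Matrix.of fun i j =>
    fderiv ℝ (fun w => fderiv ℝ f w (Pi.single j 1)) v (Pi.single i 1)

/-- The field `z × ∇g(z)` is divergence-free, by symmetry of second derivatives. -/
lemma divergence_cross_gradient_eq_zero {g : (Fin 3 → ℝ) → ℝ} (hg : ContDiff ℝ 2 g)
    (x : Fin 3 → ℝ) :
    ∑ i : Fin 3,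
      fderiv ℝ (fun z : Fin 3 → ℝ => (Qmat z *ᵥ fun k => fderiv ℝ g z (Pi.single k 1)) i)
        x (Pi.single i 1) = 0 := by
  have hdg : Differentiable ℝ (fderiv ℝ g) :=
    (hg.fderiv_right (m := 1) (by norm_num)).differentiable (by norm_num)
  have hsymm : IsSymmSndFDerivAt ℝ g x :=
    hg.contDiffAt.isSymmSndFDerivAt (by simp)
  have hcoord (i : Fin 3) :
      HasFDerivAt (fun z : Fin 3 → ℝ => z i) (ContinuousLinearMap.proj (R := ℝ) i) x :=
    hasFDerivAt_apply i x
  have hpartial (k : Fin 3) : HasFDerivAt (fun z => fderiv ℝ g z (Pi.single k 1))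
      ((fderiv ℝ (fderiv ℝ g) x).flip (Pi.single k 1)) x := by
    simpa using (hdg x).hasFDerivAt.clm_apply (hasFDerivAt_const (Pi.single k (1 : ℝ)) x)
  have hdiff (a b k l : Fin 3) :=
    ((hcoord a).mul (hpartial k)).sub ((hcoord b).mul (hpartial l))
  have h0 : (fun z : Fin 3 → ℝ => (Qmat z *ᵥ fun k => fderiv ℝ g z (Pi.single k 1)) 0) =
      fun z => z 1 * fderiv ℝ g z (Pi.single 2 1) - z 2 * fderiv ℝ g z (Pi.single 1 1) := by
    ext z; simp [Qmat, Matrix.mulVec, dotProduct, Fin.sum_univ_three]; ring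
  have h1 : (fun z : Fin 3 → ℝ => (Qmat z *ᵥ fun k => fderiv ℝ g z (Pi.single k 1)) 1) =
      fun z => z 2 * fderiv ℝ g z (Pi.single 0 1) - z 0 * fderiv ℝ g z (Pi.single 2 1) := by
    ext z; simp [Qmat, Matrix.mulVec, dotProduct, Fin.sum_univ_three]; ring
  have h2 : (fun z : Fin 3 → ℝ => (Qmat z *ᵥ fun k => fderiv ℝ g z (Pi.single k 1)) 2) =
      fun z => z 0 * fderiv ℝ g z (Pi.single 1 1) - z 1 * fderiv ℝ g z (Pi.single 0 1) := by
    ext z; simp [Qmat, Matrix.mulVec, dotProduct, Fin.sum_univ_three]; ring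
  have e0 := (hdiff 1 2 2 1).fderiv
  have e1 := (hdiff 2 0 0 2).fderiv
  have e2 := (hdiff 0 1 1 0).fderiv
  simp only [Pi.mul_def, Pi.sub_def] at e0 e1 e2
  rw [Fin.sum_univ_three, h0, h1, h2, e0, e1, e2]
  simp
  rw [hsymm.eq (Pi.single 1 1) (Pi.single 0 1), hsymm.eq (Pi.single 2 1) (Pi.single 0 1),
    hsymm.eq (Pi.single 2 1) (Pi.single 1 1)]
  ring

/-- The Hessian applied to `w` is the gradient of the directional derivative along `w`. -/
lemma hessMat_mulVec {f : (Fin 3 → ℝ) → ℝ} {v : Fin 3 → ℝ}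
    (hf : DifferentiableAt ℝ (fderiv ℝ f) v) (w : Fin 3 → ℝ) :
    hessMat f v *ᵥ w =
      fun k => fderiv ℝ (fun u => fderiv ℝ f u w) v (Pi.single k 1) := by
  have hpartial (w : Fin 3 → ℝ) : fderiv ℝ (fun u => fderiv ℝ f u w) v =
      (fderiv ℝ (fderiv ℝ f) v).flip w := by
    simpa using (hf.hasFDerivAt.clm_apply (hasFDerivAt_const w v)).fderiv
  ext k
  simp only [hessMat, Matrix.mulVec, dotProduct, Matrix.of_apply, hpartial,
    ContinuousLinearMap.flip_apply]
  conv_rhs => rw [pi_eq_sum_univ' w]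
  simp [mul_comm]

theorem divfree_kernel_is_divergence_free (f : (Fin 3 → ℝ) → ℝ) (hf : ContDiff ℝ 3 f)
    (y c : Fin 3 → ℝ) (x : Fin 3 → ℝ) :
    ∑ i : Fin 3,
      fderiv ℝ (fun z : Fin 3 → ℝ => ((Qmat z * hessMat f (z - y) * Qmat y) *ᵥ c) i)
        x (Pi.single i 1) = 0 := by
  have hdf : ContDiff ℝ 2 (fderiv ℝ f) := hf.fderiv_right (by norm_num)
  have hg : ContDiff ℝ 2 (fun z => fderiv ℝ f (z - y) (Qmat y *ᵥ c)) :=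
    (hdf.comp (contDiff_id.sub contDiff_const)).clm_apply contDiff_const
  have hfield (z : Fin 3 → ℝ) : (Qmat z * hessMat f (z - y) * Qmat y) *ᵥ c =
      Qmat z *ᵥ fun k =>
        fderiv ℝ (fun u => fderiv ℝ f (u - y) (Qmat y *ᵥ c)) z (Pi.single k 1) := by
    rw [← Matrix.mulVec_mulVec, ← Matrix.mulVec_mulVec,
      hessMat_mulVec (hdf.differentiable (by norm_num) _)]
    simp only [fderiv_comp_sub (f := fun u => fderiv ℝ f u (Qmat y *ᵥ c))]
  simp only [hfield]
  exact divergence_cross_gradient_eq_zero hg x
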